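/- arXiv:2503.09525 — 3 statements merged into one kernel-verified Lean document; each statement's English description precedes it below -/
import Mathlib

section
/- There exist real constants β > 0 and c > 0 such that for every natural number n ≥ 2 there exists a set L of n lines in the plane ℝ² that admits a monotone path of length at least β · n^{2 − c/√(log₂ n)}. -/
/-- `l` is a line in the plane `ℝ²`. -/
def IsLine (l : Set (ℝ × ℝ)) : Prop :=
  ∃ a b c : ℝ, (a, b) ≠ (0, 0) ∧ l = {p : ℝ × ℝ | a * p.1 + b * p.2 = c}

/-- The set `L` of lines admits a monotone path of length `k`: there are vertices
`v 0, …, v k`, each an intersection point of two distinct lines of `L`, such that each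
segment `[v i, v (i+1)]` lies on a line of `L`, no three consecutive vertices are
collinear (so that `k` is the minimum number of segments needed), and there is a
direction `u ≠ 0` such that the orthogonal projection `p ↦ ⟨u, p⟩` is injective on the
union of the segments of the path. -/
def HasMonotonePathOfLength (L : Finset (Set (ℝ × ℝ))) (k : ℕ) : Prop :=
  ∃ v : ℕ → ℝ × ℝ,
    (∀ i ≤ k, ∃ l₁ ∈ L, ∃ l₂ ∈ L, l₁ ≠ l₂ ∧ v i ∈ l₁ ∧ v i ∈ l₂) ∧
    (∀ i < k, ∃ l ∈ L, segment ℝ (v i) (v (i + 1)) ⊆ l) ∧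
    (∀ i, i + 2 ≤ k → ¬ Collinear ℝ ({v i, v (i + 1), v (i + 2)} : Set (ℝ × ℝ))) ∧
    ∃ u : ℝ × ℝ, u ≠ 0 ∧
      Set.InjOn (fun p : ℝ × ℝ => u.1 * p.1 + u.2 * p.2)
        (⋃ i ∈ Finset.range k, segment ℝ (v i) (v (i + 1)))

/-- The linear form `(x, y) ↦ F_k x + F_{k+1} y` with consecutive Fibonacci coefficients. -/
noncomputable def fibForm (k : ℕ) (p : ℝ × ℝ) : ℝ :=
  (Nat.fib k : ℝ) * p.1 + (Nat.fib (k + 1) : ℝ) * p.2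

theorem Nat.fib_cassini_even {k : ℕ} (hk : Even k) :
    Nat.fib (k + 1) * Nat.fib (k + 1) = Nat.fib k * Nat.fib (k + 2) + 1 := by
  obtain ⟨j, rfl⟩ := hk
  induction j with
  | zero => simp
  | succ j ih =>
    have h2 : Nat.fib (j + j + 2) = Nat.fib (j + j) + Nat.fib (j + j + 1) := Nat.fib_add_two
    have h3 : Nat.fib (j + j + 3) = Nat.fib (j + j + 1) + Nat.fib (j + j + 2) := Nat.fib_add_two
    have h4 : Nat.fib (j + j + 4) = Nat.fib (j + j + 2) + Nat.fib (j + j + 3) := Nat.fib_add_two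
    rw [show j + 1 + (j + 1) = j + j + 2 by ring, show j + j + 2 + 1 = j + j + 3 by ring,
      show j + j + 2 + 2 = j + j + 4 by ring]
    rw [h4, h3]
    rw [h2] at ih ⊢
    nlinarith

theorem exists_even_fib_ge (N : ℕ) (hN : 1 ≤ N) :
    ∃ κ, Even κ ∧ N ≤ Nat.fib κ ∧ Nat.fib (κ + 3) ≤ 16 * N := by
  have hex : ∃ m, N ≤ Nat.fib (2 * m) := by
    refine ⟨N + 5, (Nat.le_fib_self (by omega)).trans' (by omega)⟩
  classical
  have hspec := Nat.find_spec hex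
  have hmin := @Nat.find_min _ _ hex
  generalize Nat.find hex = m at hspec hmin
  obtain _ | m := m
  · simp at hspec; omega
  refine ⟨2 * (m + 1), even_two_mul _, hspec, ?_⟩
  have hm := hmin (Nat.lt_succ_self m)
  have h1 : Nat.fib (2 * m + 1) ≤ 2 * Nat.fib (2 * m) + 1 := by
    rcases m with _ | m
    · simp
    · have : Nat.fib (2 * (m + 1) + 1) = Nat.fib (2 * m + 1) + Nat.fib (2 * m + 2) :=
        Nat.fib_add_two
      have h' : Nat.fib (2 * m + 1) ≤ Nat.fib (2 * m + 2) := Nat.fib_mono (by omega)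
      rw [show 2 * (m + 1) = 2 * m + 2 by ring] at *
      omega
  have h2 : Nat.fib (2 * m + 2) = Nat.fib (2 * m) + Nat.fib (2 * m + 1) := Nat.fib_add_two
  have h3 : Nat.fib (2 * m + 3) = Nat.fib (2 * m + 1) + Nat.fib (2 * m + 2) := Nat.fib_add_two
  have h4 : Nat.fib (2 * m + 4) = Nat.fib (2 * m + 2) + Nat.fib (2 * m + 3) := Nat.fib_add_two
  have h5 : Nat.fib (2 * m + 5) = Nat.fib (2 * m + 3) + Nat.fib (2 * m + 4) := Nat.fib_add_two
  rw [show 2 * (m + 1) + 3 = 2 * m + 5 by ring]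
  omega

theorem fib_form_lt_of_lt {A B C x y N : ℤ} (hA : 0 < A) (hB : A ≤ B)
    (hcas : B * B = A * C + 1) (hN : N ≤ A) (hy : y < N)
    (h : 0 < A * x + B * y) : 0 < B * x + C * y := by
  by_contra! hc
  have hid : y = -A * (B * x + C * y) + B * (A * x + B * y) := by
    linear_combination (-y) * hcas
  nlinarith

theorem fib_form_injective {A B C x y N : ℤ} (hA : 0 < A)
    (hcas : B * B = A * C + 1) (hN : N ≤ A) (hy : |y| < N)
    (h : A * x + B * y = 0) : x = 0 ∧ y = 0 := by
  have hid : y = A * -(B * x + C * y) := by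
    linear_combination (-y) * hcas + B * h
  have hy0 : y = 0 := Int.eq_zero_of_abs_lt_dvd ⟨_, hid⟩ (hy.trans_le hN)
  subst hy0
  simp at h
  omega

/-- The points of an `N × N` grid can be listed so that two consecutive Fibonacci forms both
increase along the list. -/
theorem exists_box_enumeration {N κ : ℕ} (hN : 1 ≤ N) (hκ : Even κ) (hNκ : N ≤ Nat.fib κ) :
    ∃ g : ℕ → ℕ × ℕ, (∀ j < N ^ 2, (g j).1 < N ∧ (g j).2 < N) ∧
      ∀ j, j + 1 < N ^ 2 →
        Nat.fib κ * (g j).1 + Nat.fib (κ + 1) * (g j).2 <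
          Nat.fib κ * (g (j + 1)).1 + Nat.fib (κ + 1) * (g (j + 1)).2 ∧
        Nat.fib (κ + 1) * (g j).1 + Nat.fib (κ + 2) * (g j).2 <
          Nat.fib (κ + 1) * (g (j + 1)).1 + Nat.fib (κ + 2) * (g (j + 1)).2 := by
  have hcas : (Nat.fib (κ + 1) : ℤ) * Nat.fib (κ + 1) = Nat.fib κ * Nat.fib (κ + 2) + 1 := by
    exact_mod_cast Nat.fib_cassini_even hκ
  have hB : (Nat.fib κ : ℤ) ≤ Nat.fib (κ + 1) := by exact_mod_cast Nat.fib_le_fib_succ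
  have hA : (0 : ℤ) < Nat.fib κ := by exact_mod_cast hN.trans hNκ
  have hNA : (N : ℤ) ≤ Nat.fib κ := by exact_mod_cast hNκ
  generalize (Nat.fib κ) = A at *
  generalize (Nat.fib (κ + 1)) = B at *
  generalize (Nat.fib (κ + 2)) = C at *
  set f : ℕ × ℕ → ℕ := fun q => A * q.1 + B * q.2 with hf
  set S := (Finset.range N) ×ˢ (Finset.range N) with hS
  have hinj : Set.InjOn f S := by
    rintro ⟨a, b⟩ h1 ⟨a', b'⟩ h2 h
    simp only [hS, Finset.coe_product, Finset.coe_range, Set.mem_prod, Set.mem_Iio] at h1 h2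
    simp only [hf] at h
    have h' : (A : ℤ) * a + B * b = A * a' + B * b' := by exact_mod_cast h
    have := fib_form_injective (A := A) (B := B) (C := C) (x := a - a') (y := b - b') (N := N)
      hA hcas hNA (by rw [abs_lt]; omega) (by linear_combination h')
    ext <;> simp <;> omega
  have hcard : (S.image f).card = N ^ 2 := by
    rw [Finset.card_image_of_injOn hinj]; simp [hS, sq]
  set e := (S.image f).orderEmbOfFin hcard
  have he : ∀ j : Fin (N ^ 2), ∃ q ∈ S, f q = e j := fun j =>
    Finset.mem_image.1 (Finset.orderEmbOfFin_mem _ hcard j)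
  choose g hgS hge using he
  refine ⟨fun j => if h : j < N ^ 2 then g ⟨j, h⟩ else 0, fun j hj => ?_, fun j hj => ?_⟩
  · have := hgS ⟨j, hj⟩
    simp only [hS, Finset.mem_product, Finset.mem_range] at this
    simpa [hj] using this
  · have hj' : j < N ^ 2 := by omega
    have hlt : e ⟨j, hj'⟩ < e ⟨j + 1, hj⟩ := e.strictMono (by simp [Fin.lt_def])
    have h1 := hgS ⟨j, hj'⟩
    have h2 := hgS ⟨j + 1, hj⟩
    rw [← hge, ← hge] at hlt
    simp only [hj, hj', dif_pos]
    generalize g ⟨j, hj'⟩ = q at *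
    generalize g ⟨j + 1, hj⟩ = q' at *
    simp only [hS, Finset.mem_product, Finset.mem_range] at h1 h2
    simp only [hf] at hlt
    refine ⟨hlt, ?_⟩
    have h' : (A : ℤ) * q.1 + B * q.2 < A * q'.1 + B * q'.2 := by exact_mod_cast hlt
    have := fib_form_lt_of_lt (A := A) (B := B) (C := C) (x := q'.1 - q.1) (y := q'.2 - q.2)
      (N := N) hA hB hcas hNA (by omega) (by linarith)
    zify
    linarith

theorem fibForm_add (k : ℕ) (p q : ℝ × ℝ) : fibForm k (p + q) = fibForm k p + fibForm k q := by
  simp only [fibForm, Prod.fst_add, Prod.snd_add]; ring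

theorem fibForm_smul (k : ℕ) (c : ℝ) (p : ℝ × ℝ) : fibForm k (c • p) = c * fibForm k p := by
  simp only [fibForm, Prod.smul_fst, Prod.smul_snd, smul_eq_mul]; ring

/-- There is a sequence of points `p 0, …, p M` such that each step has positive coordinates with
respect to a pair of consecutive Fibonacci forms of even index, the steps determine at most
`lines` level lines of either kind, and the points lie on at most `width k` level lines of
the `k`-th form. -/
def Realizable (M lines : ℕ) (width : ℕ → ℕ) : Prop :=
  ∃ (p : ℕ → ℝ × ℝ) (t : ℕ → ℕ),
    (∀ m < M, Even (t m) ∧ fibForm (t m) (p m) < fibForm (t m) (p (m + 1)) ∧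
      fibForm (t m + 1) (p m) < fibForm (t m + 1) (p (m + 1))) ∧
    ((Finset.range M).image fun m => (t m, fibForm (t m) (p m))).card ≤ lines ∧
    ((Finset.range M).image fun m => (t m, fibForm (t m + 1) (p (m + 1)))).card ≤ lines ∧
    ∀ k, ((Finset.range (M + 1)).image fun m => fibForm k (p m)).card ≤ width k

theorem realizable_zero : Realizable 0 0 fun _ => 1 :=
  ⟨fun _ => 0, fun _ => 0, by simp, by simp, by simp, fun k => by simp⟩

open Filter Topology in
theorem exists_pos_forall_add_mul_lt {ι : Type*} (s : Finset ι) (a b c d : ι → ℝ)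
    (h : ∀ i ∈ s, a i < b i) : ∃ ε : ℝ, 0 < ε ∧ ∀ i ∈ s, a i + ε * c i < b i + ε * d i := by
  have key : ∀ᶠ ε in 𝓝[>] (0 : ℝ), ∀ i ∈ s, a i + ε * c i < b i + ε * d i := by
    rw [Filter.eventually_all_finset]
    intro i hi
    refine Filter.Eventually.filter_mono nhdsWithin_le_nhds ?_
    have h1 : Tendsto (fun ε : ℝ => a i + ε * c i) (𝓝 0) (𝓝 (a i + 0 * c i)) :=
      Continuous.tendsto (by fun_prop) 0
    have h2 : Tendsto (fun ε : ℝ => b i + ε * d i) (𝓝 0) (𝓝 (b i + 0 * d i)) :=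
      Continuous.tendsto (by fun_prop) 0
    exact h1.eventually_lt h2 (by simpa using h i hi)
  obtain ⟨ε, h1, h2⟩ := (key.and self_mem_nhdsWithin).exists
  exact ⟨ε, h2, h1⟩

/-- Replace every point by a small monotone enumeration of an `N × N` grid. -/
theorem Realizable.refine {M Λ : ℕ} {B : ℕ → ℕ} (h : Realizable M Λ B) {N κ : ℕ} (hN : 1 ≤ N)
    (hκ : Even κ) (hNκ : N ≤ Nat.fib κ) :
    Realizable ((M + 1) * N ^ 2 - 1) (Λ + (B κ + B (κ + 1)) * N ^ 2)
      fun k => B k * (Nat.fib (k + 2) * N) := by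
  obtain ⟨p, t, hstep, hdown, hup, hwidth⟩ := h
  obtain ⟨g, hg, hgstep⟩ := exists_box_enumeration hN hκ hNκ
  set G : ℕ → ℝ × ℝ := fun j => ((g j).1, (g j).2) with hG
  have hGform : ∀ k j, fibForm k (G j) =
      ((Nat.fib k * (g j).1 + Nat.fib (k + 1) * (g j).2 : ℕ) : ℝ) := by
    intro k j; simp [fibForm, hG]
  have hQ0 : 0 < N ^ 2 := by positivity
  generalize hQ : N ^ 2 = Q at *
  obtain ⟨ε, hε, hεstep⟩ := exists_pos_forall_add_mul_lt
    (Finset.range M ×ˢ Finset.range 2)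
    (fun i => fibForm (t i.1 + i.2) (p i.1)) (fun i => fibForm (t i.1 + i.2) (p (i.1 + 1)))
    (fun i => fibForm (t i.1 + i.2) (G (Q - 1))) (fun i => fibForm (t i.1 + i.2) (G 0)) (by
      rintro ⟨m, i⟩ hi
      simp only [Finset.mem_product, Finset.mem_range] at hi
      obtain ⟨h1, h2⟩ := hi
      interval_cases i
      · exact (hstep m h1).2.1
      · exact (hstep m h1).2.2)
  set p' : ℕ → ℝ × ℝ := fun m => p (m / Q) + ε • G (m % Q) with hp'
  set t' : ℕ → ℕ := fun m => if m % Q + 1 = Q then t (m / Q) else κ with ht'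
  have hform : ∀ k m, fibForm k (p' m) = fibForm k (p (m / Q)) + ε * fibForm k (G (m % Q)) := by
    intro k m; simp only [hp', fibForm_add, fibForm_smul]
  have hcase : ∀ m < (M + 1) * Q - 1,
      (m % Q = Q - 1 ∧ t' m = t (m / Q) ∧ m / Q < M ∧ (m + 1) / Q = m / Q + 1 ∧ (m + 1) % Q = 0) ∨
      (m % Q + 1 < Q ∧ t' m = κ ∧ m / Q < M + 1 ∧ (m + 1) / Q = m / Q ∧
        (m + 1) % Q = m % Q + 1) := by
    intro m hm
    have hlt := Nat.mod_lt m hQ0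
    have hdm := Nat.div_add_mod m Q
    by_cases hl : m % Q + 1 = Q
    · left
      have e : m + 1 = Q * (m / Q + 1) := by rw [mul_add, mul_one]; omega
      refine ⟨by omega, by simp [ht', hl], ?_, ?_, ?_⟩
      · have : Q * (m / Q + 1) < Q * (M + 1) := by rw [← e, mul_comm Q]; omega
        have := Nat.lt_of_mul_lt_mul_left this
        omega
      · rw [e, Nat.mul_div_cancel_left _ hQ0]
      · rw [e, Nat.mul_mod_right]
    · right
      have e : m + 1 = (m % Q + 1) + Q * (m / Q) := by omega
      have hlt' : m % Q + 1 < Q := by omega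
      refine ⟨hlt', by simp [ht', hl], ?_, ?_, ?_⟩
      · rw [Nat.div_lt_iff_lt_mul hQ0]; omega
      · rw [e, Nat.add_mul_div_left _ _ hQ0, Nat.div_eq_of_lt hlt', zero_add]
      · rw [e, Nat.add_mul_mod_self_left, Nat.mod_eq_of_lt hlt']
  refine ⟨p', t', ?_, ?_, ?_, ?_⟩
  · intro m hm
    rcases hcase m hm with ⟨h1, h2, h3, h4, h5⟩ | ⟨h1, h2, h3, h4, h5⟩
    · simp only [hform, h1, h2, h4, h5]
      refine ⟨(hstep _ h3).1, ?_, ?_⟩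
      · simpa using hεstep (m / Q, 0) (by simp [h3])
      · simpa using hεstep (m / Q, 1) (by simp [h3])
    · simp only [hform, h2, h4, h5, hGform]
      obtain ⟨ha, hb⟩ := hgstep _ h1
      refine ⟨hκ, ?_, ?_⟩
      · gcongr
      · gcongr
  · calc _ ≤ ((((Finset.range M).image fun m => (t m, fibForm (t m) (p m))).image
            fun q => (q.1, q.2 + ε * fibForm q.1 (G (Q - 1)))) ∪
          ((((Finset.range (M + 1)).image fun m => fibForm κ (p m)) ×ˢ Finset.range Q).image
            fun q => (κ, q.1 + ε * fibForm κ (G q.2)))).card := by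
          refine Finset.card_le_card fun q hq => ?_
          obtain ⟨m, hm, rfl⟩ := Finset.mem_image.1 hq
          rcases hcase m (Finset.mem_range.1 hm) with ⟨h1, h2, h3, -, -⟩ | ⟨h1, h2, h3, -, -⟩
          · refine Finset.mem_union_left _ (Finset.mem_image.2 ⟨_, Finset.mem_image_of_mem _
              (Finset.mem_range.2 h3), ?_⟩)
            simp only [hform, h1, h2]
          · refine Finset.mem_union_right _ (Finset.mem_image.2 ⟨(fibForm κ (p (m / Q)), m % Q),
              Finset.mem_product.2 ⟨Finset.mem_image_of_mem (fun m => fibForm κ (p m))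
                (Finset.mem_range.2 h3),
                Finset.mem_range.2 (Nat.mod_lt _ hQ0)⟩, ?_⟩)
            simp only [hform, h2]
      _ ≤ Λ + B κ * Q := by
          refine (Finset.card_union_le _ _).trans (add_le_add
            (Finset.card_image_le.trans hdown) (Finset.card_image_le.trans ?_))
          rw [Finset.card_product, Finset.card_range]
          gcongr
          exact hwidth κ
      _ ≤ _ := by gcongr; omega
  · calc _ ≤ ((((Finset.range M).image fun m => (t m, fibForm (t m + 1) (p (m + 1)))).image
            fun q => (q.1, q.2 + ε * fibForm (q.1 + 1) (G 0))) ∪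
          ((((Finset.range (M + 1)).image fun m => fibForm (κ + 1) (p m)) ×ˢ Finset.range Q).image
            fun q => (κ, q.1 + ε * fibForm (κ + 1) (G q.2)))).card := by
          refine Finset.card_le_card fun q hq => ?_
          obtain ⟨m, hm, rfl⟩ := Finset.mem_image.1 hq
          rcases hcase m (Finset.mem_range.1 hm) with ⟨h1, h2, h3, h4, h5⟩ | ⟨h1, h2, h3, h4, h5⟩
          · refine Finset.mem_union_left _ (Finset.mem_image.2 ⟨_, Finset.mem_image_of_mem _
              (Finset.mem_range.2 h3), ?_⟩)
            simp only [hform, h4, h5, h2]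
          · refine Finset.mem_union_right _ (Finset.mem_image.2 ⟨(fibForm (κ + 1) (p (m / Q)),
              m % Q + 1), Finset.mem_product.2 ⟨Finset.mem_image_of_mem
                (fun m => fibForm (κ + 1) (p m)) (Finset.mem_range.2 h3),
                Finset.mem_range.2 h1⟩, ?_⟩)
            simp only [hform, h2, h4, h5]
      _ ≤ Λ + B (κ + 1) * Q := by
          refine (Finset.card_union_le _ _).trans (add_le_add
            (Finset.card_image_le.trans hup) (Finset.card_image_le.trans ?_))
          rw [Finset.card_product, Finset.card_range]
          gcongr
          exact hwidth (κ + 1)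
      _ ≤ _ := by gcongr; omega
  · intro k
    calc _ ≤ ((((Finset.range (M + 1)).image fun m => fibForm k (p m)) ×ˢ
            Finset.range (Nat.fib (k + 2) * N)).image fun q => q.1 + ε * (q.2 : ℝ)).card := by
          refine Finset.card_le_card fun q hq => ?_
          obtain ⟨m, hm, rfl⟩ := Finset.mem_image.1 hq
          have hm' : m < (M + 1) * Q := by
            have := Finset.mem_range.1 hm
            have : 0 < (M + 1) * Q := by positivity
            omega
          have hdiv : m / Q < M + 1 := by rwa [Nat.div_lt_iff_lt_mul hQ0]
          obtain ⟨hb1, hb2⟩ := hg (m % Q) (Nat.mod_lt _ hQ0)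
          refine Finset.mem_image.2 ⟨(fibForm k (p (m / Q)),
            Nat.fib k * (g (m % Q)).1 + Nat.fib (k + 1) * (g (m % Q)).2), Finset.mem_product.2
            ⟨Finset.mem_image_of_mem (fun m => fibForm k (p m)) (Finset.mem_range.2 hdiv),
              Finset.mem_range.2 ?_⟩, by simp only [hform, hGform]⟩
          have hpos : 0 < Nat.fib (k + 1) := Nat.fib_pos.2 (by omega)
          rw [Nat.fib_add_two, add_mul]
          exact add_lt_add_of_le_of_lt (Nat.mul_le_mul_left _ hb1.le)
            (Nat.mul_lt_mul_of_pos_left hb2 hpos)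
      _ ≤ _ := by
          refine Finset.card_image_le.trans ?_
          rw [Finset.card_product, Finset.card_range]
          exact Nat.mul_le_mul_right _ (hwidth k)

theorem injOn_iUnion_segment_of_lt {E : Type*} [AddCommGroup E] [Module ℝ E] (f : E →ₗ[ℝ] ℝ)
    (v : ℕ → E) (K : ℕ) (h : ∀ i < K, f (v i) < f (v (i + 1))) :
    Set.InjOn f (⋃ i ∈ Finset.range K, segment ℝ (v i) (v (i + 1))) := by
  have hmono : ∀ i j, i ≤ j → j ≤ K → f (v i) ≤ f (v j) := by
    intro i j hij
    induction j, hij using Nat.le_induction with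
    | base => simp
    | succ j _ ih => exact fun hj => (ih (by omega)).trans (h j (by omega)).le
  have hval : ∀ i θ, f (v i + θ • (v (i + 1) - v i)) = f (v i) + θ * (f (v (i + 1)) - f (v i)) := by
    intro i θ; simp
  have key : ∀ i j, i ≤ j → j < K → ∀ θ ∈ Set.Icc (0 : ℝ) 1, ∀ η ∈ Set.Icc (0 : ℝ) 1,
      f (v i) + θ * (f (v (i + 1)) - f (v i)) = f (v j) + η * (f (v (j + 1)) - f (v j)) →
      v i + θ • (v (i + 1) - v i) = v j + η • (v (j + 1) - v j) := by
    intro i j hij hj θ hθ η hη heq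
    have hi := sub_pos.2 (h i (by omega))
    have hj' := sub_pos.2 (h j hj)
    rcases hij.eq_or_lt with rfl | hlt
    · rw [mul_right_cancel₀ hi.ne' (add_left_cancel heq)]
    · have h1 := hmono (i + 1) j hlt hj.le
      have hθ1 : θ = 1 := by
        by_contra hne
        have := hθ.2.lt_of_ne hne
        nlinarith [mul_nonneg hη.1 hj'.le]
      subst hθ1
      have hη0 : η = 0 := by
        by_contra hne
        have := hη.1.lt_of_ne' hne
        nlinarith [mul_pos this hj']
      subst hη0
      have hji : j = i + 1 := by
        by_contra hne
        have := hmono (i + 2) j (by omega) hj.le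
        have := h (i + 1) (by omega)
        linarith
      subst hji
      simp
  intro p hp q hq hpq
  simp only [Set.mem_iUnion, Finset.mem_range, segment_eq_image', Set.mem_image] at hp hq
  obtain ⟨i, hi, θ, hθ, rfl⟩ := hp
  obtain ⟨j, hj, η, hη, rfl⟩ := hq
  rw [hval, hval] at hpq
  rcases le_total i j with hij | hij
  · exact key i j hij hj θ hθ η hη hpq
  · exact (key j i hij hi η hη θ hθ hpq.symm).symm

theorem Collinear.cross_eq_zero {a b c : ℝ × ℝ} (h : Collinear ℝ ({a, b, c} : Set (ℝ × ℝ))) :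
    (b - a).1 * (c - b).2 - (b - a).2 * (c - b).1 = 0 := by
  obtain ⟨w, hw⟩ := (collinear_iff_of_mem (p₀ := a) (by simp)).1 h
  obtain ⟨r, hr⟩ := hw b (by simp)
  obtain ⟨s, hs⟩ := hw c (by simp)
  simp only [hr, hs, vadd_eq_add, Prod.fst_sub, Prod.snd_sub, Prod.fst_add, Prod.snd_add,
    Prod.smul_fst, Prod.smul_snd, smul_eq_mul]
  ring

theorem IsLine.cross_eq_zero {l : Set (ℝ × ℝ)} (hl : IsLine l) {a b c : ℝ × ℝ} (ha : a ∈ l)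
    (hb : b ∈ l) (hc : c ∈ l) : (b - a).1 * (c - b).2 - (b - a).2 * (c - b).1 = 0 := by
  obtain ⟨r, s, e, hne, rfl⟩ := hl
  simp only [Set.mem_ofPred_eq] at ha hb hc
  simp only [Prod.fst_sub, Prod.snd_sub]
  have h : r ≠ 0 ∨ s ≠ 0 := by
    by_contra! h
    exact hne (by simp [h])
  rcases h with h | h
  · apply mul_left_cancel₀ h
    linear_combination (c.2 - b.2) * (hb - ha) - (b.2 - a.2) * (hc - hb)
  · apply mul_left_cancel₀ h
    linear_combination (b.1 - a.1) * (hc - hb) - (c.1 - b.1) * (hb - ha)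

theorem IsLine.segment_subset {l : Set (ℝ × ℝ)} (hl : IsLine l) {a b : ℝ × ℝ} (ha : a ∈ l)
    (hb : b ∈ l) : segment ℝ a b ⊆ l := by
  obtain ⟨r, s, e, -, rfl⟩ := hl
  rintro _ ⟨θ, η, -, -, hsum, rfl⟩
  simp only [Set.mem_ofPred_eq, Prod.fst_add, Prod.snd_add, Prod.smul_fst, Prod.smul_snd,
    smul_eq_mul] at ha hb ⊢
  linear_combination θ * ha + η * hb + e * hsum

theorem hasMonotonePathOfLength_of_zigzag {L : Finset (Set (ℝ × ℝ))} (hL : ∀ l ∈ L, IsLine l)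
    {K : ℕ} {z : ℕ → ℝ × ℝ} {u : ℝ × ℝ}
    (hlines : ∀ j < K + 2, ∃ l ∈ L, z j ∈ l ∧ z (j + 1) ∈ l)
    (hu : ∀ j < K + 2, u.1 * (z j).1 + u.2 * (z j).2 < u.1 * (z (j + 1)).1 + u.2 * (z (j + 1)).2)
    (hcross : ∀ j < K + 1, (z (j + 1) - z j).1 * (z (j + 2) - z (j + 1)).2 -
      (z (j + 1) - z j).2 * (z (j + 2) - z (j + 1)).1 ≠ 0) :
    HasMonotonePathOfLength L K := by
  refine ⟨fun i => z (i + 1), fun i hi => ?_, fun i hi => ?_, fun i hi h => ?_, u, ?_, ?_⟩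
  · obtain ⟨l, hl, h1, h2⟩ := hlines i (by omega)
    obtain ⟨l', hl', h1', h2'⟩ := hlines (i + 1) (by omega)
    refine ⟨l, hl, l', hl', ?_, h2, h1'⟩
    rintro rfl
    exact hcross i (by omega) ((hL l hl).cross_eq_zero h1 h2 h2')
  · obtain ⟨l, hl, h1, h2⟩ := hlines (i + 1) (by omega)
    exact ⟨l, hl, (hL l hl).segment_subset h1 h2⟩
  · exact hcross (i + 1) (by omega) h.cross_eq_zero
  · rintro rfl
    simpa using hu 0 (by omega)
  · exact injOn_iUnion_segment_of_lt
      (u.1 • LinearMap.fst ℝ ℝ ℝ + u.2 • LinearMap.snd ℝ ℝ ℝ) (fun i => z (i + 1)) K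
      fun i hi => by simpa using hu (i + 1) (by omega)

theorem isLine_fibForm (k : ℕ) (c : ℝ) : IsLine {x | fibForm k x = c} := by
  refine ⟨Nat.fib k, Nat.fib (k + 1), c, fun h => ?_, rfl⟩
  have : Nat.fib (k + 1) = 0 := by exact_mod_cast (Prod.mk.inj h).2
  exact (Nat.fib_pos.2 (Nat.succ_pos k)).ne' this

open Real in
/-- A step that is positive for two consecutive Fibonacci forms splits into a step along a level
line of the first form followed by a step along a level line of the second form. -/
theorem exists_corner {k : ℕ} (hk : Even k) {p q : ℝ × ℝ} (h0 : fibForm k p < fibForm k q)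
    (h1 : fibForm (k + 1) p < fibForm (k + 1) q) :
    ∃ r : ℝ × ℝ, fibForm k r = fibForm k p ∧ fibForm (k + 1) r = fibForm (k + 1) q ∧
      p.1 + goldenRatio * p.2 < r.1 + goldenRatio * r.2 ∧
      r.1 + goldenRatio * r.2 < q.1 + goldenRatio * q.2 ∧ r.2 ≤ p.2 ∧ r.2 < q.2 := by
  have hcas : (Nat.fib (k + 1) : ℝ) * Nat.fib (k + 1) = Nat.fib k * Nat.fib (k + 2) + 1 := by
    exact_mod_cast Nat.fib_cassini_even hk
  have hdown : (0 : ℝ) < Nat.fib (k + 1) - goldenRatio * Nat.fib k := by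
    rw [fib_succ_sub_goldenRatio_mul_fib]
    exact hk.pow_pos goldenConj_neg.ne
  have hup : (Nat.fib (k + 2) : ℝ) - goldenRatio * Nat.fib (k + 1) < 0 := by
    rw [fib_succ_sub_goldenRatio_mul_fib]
    exact (hk.add_one).pow_neg goldenConj_neg
  have hk0 : (0 : ℝ) ≤ Nat.fib k := Nat.cast_nonneg _
  have hk1 : (0 : ℝ) < Nat.fib (k + 1) := by exact_mod_cast Nat.fib_pos.2 (Nat.succ_pos k)
  simp only [fibForm, show k + 1 + 1 = k + 2 from rfl] at h0 h1 ⊢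
  generalize (Nat.fib k : ℝ) = A at *
  generalize (Nat.fib (k + 1) : ℝ) = B at *
  generalize (Nat.fib (k + 2) : ℝ) = C at *
  generalize goldenRatio = φ at *
  set α := B * q.1 + C * q.2 - (B * p.1 + C * p.2) with hα
  set β := A * q.1 + B * q.2 - (A * p.1 + B * p.2) with hβ
  have hα0 : 0 < α := sub_pos.2 h1
  have hβ0 : 0 < β := sub_pos.2 h0
  have hq1 : q.1 = p.1 + α * B - β * C := by
    rw [hα, hβ]; linear_combination (-(q.1 - p.1)) * hcas
  have hq2 : q.2 = p.2 - α * A + β * B := by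
    rw [hα, hβ]; linear_combination (-(q.2 - p.2)) * hcas
  refine ⟨(p.1 + α * B, p.2 - α * A), ?_, ?_, ?_, ?_, ?_, ?_⟩ <;> simp only
  · ring
  · rw [hα]; linear_combination (B * q.1 + C * q.2 - (B * p.1 + C * p.2)) * hcas
  · nlinarith [mul_pos hα0 hdown]
  · rw [hq1, hq2]; nlinarith [mul_pos hβ0 (neg_pos.2 hup)]
  · nlinarith [mul_nonneg hα0.le hk0]
  · rw [hq2]; nlinarith [mul_pos hβ0 hk1]

theorem cross_eq_shear (a b : ℝ × ℝ) (φ : ℝ) : a.1 * b.2 - a.2 * b.1 =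
    (a.1 + φ * a.2) * b.2 - a.2 * (b.1 + φ * b.2) := by ring

open Real in
theorem Realizable.exists_lines {M Λ : ℕ} {B : ℕ → ℕ} (h : Realizable M Λ B) (hM : 1 ≤ M) :
    ∃ L : Finset (Set (ℝ × ℝ)), (∀ l ∈ L, IsLine l) ∧ L.card ≤ 2 * Λ ∧
      HasMonotonePathOfLength L (2 * M - 2) := by
  classical
  obtain ⟨p, t, hstep, hdown, hup, -⟩ := h
  have hq : ∀ m, ∃ r : ℝ × ℝ, m < M → fibForm (t m) r = fibForm (t m) (p m) ∧
      fibForm (t m + 1) r = fibForm (t m + 1) (p (m + 1)) ∧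
      (p m).1 + goldenRatio * (p m).2 < r.1 + goldenRatio * r.2 ∧
      r.1 + goldenRatio * r.2 < (p (m + 1)).1 + goldenRatio * (p (m + 1)).2 ∧
      r.2 ≤ (p m).2 ∧ r.2 < (p (m + 1)).2 := by
    intro m
    by_cases hm : m < M
    · obtain ⟨r, hr⟩ := exists_corner (hstep m hm).1 (hstep m hm).2.1 (hstep m hm).2.2
      exact ⟨r, fun _ => hr⟩
    · exact ⟨0, fun h => absurd h hm⟩
  choose q hq using hq
  set D := (Finset.range M).image fun m => (t m, fibForm (t m) (p m)) with hD
  set U := (Finset.range M).image fun m => (t m, fibForm (t m + 1) (p (m + 1))) with hU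
  set z : ℕ → ℝ × ℝ := fun n => if n % 2 = 0 then p (n / 2) else q (n / 2) with hz
  have hz0 : ∀ m, z (2 * m) = p m := fun m => by simp [hz]
  have hz1 : ∀ m, z (2 * m + 1) = q m := fun m => by
    simp [hz, Nat.add_mod, show (2 * m + 1) / 2 = m by omega]
  have hlines : ∀ l ∈ D.image (fun a => {x : ℝ × ℝ | fibForm a.1 x = a.2}) ∪
      U.image (fun a => {x : ℝ × ℝ | fibForm (a.1 + 1) x = a.2}), IsLine l := by
    intro l hl
    rcases Finset.mem_union.1 hl with hl | hl <;> obtain ⟨a, -, rfl⟩ := Finset.mem_image.1 hl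
    · exact isLine_fibForm _ _
    · exact isLine_fibForm _ _
  refine ⟨_, hlines, ?_, hasMonotonePathOfLength_of_zigzag (z := z) (u := (1, goldenRatio)) hlines
    ?_ ?_ ?_⟩
  · have := Finset.card_union_le (D.image (fun a => {x : ℝ × ℝ | fibForm a.1 x = a.2}))
      (U.image (fun a => {x : ℝ × ℝ | fibForm (a.1 + 1) x = a.2}))
    have h1 : (D.image (fun a => {x : ℝ × ℝ | fibForm a.1 x = a.2})).card ≤ D.card :=
      Finset.card_image_le
    have h2 : (U.image (fun a => {x : ℝ × ℝ | fibForm (a.1 + 1) x = a.2})).card ≤ U.card :=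
      Finset.card_image_le
    omega
  · intro j hj
    obtain ⟨m, rfl | rfl⟩ : ∃ m, j = 2 * m ∨ j = 2 * m + 1 := ⟨j / 2, by omega⟩
    · have hm : m < M := by omega
      refine ⟨_, Finset.mem_union_left _ (Finset.mem_image_of_mem _
        (Finset.mem_image_of_mem _ (Finset.mem_range.2 hm))), ?_, ?_⟩
      · simp [hz0]
      · simpa [hz1] using (hq m hm).1
    · have hm : m < M := by omega
      refine ⟨_, Finset.mem_union_right _ (Finset.mem_image_of_mem _
        (Finset.mem_image_of_mem _ (Finset.mem_range.2 hm))), ?_, ?_⟩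
      · simpa [hz1] using (hq m hm).2.1
      · simp [show 2 * m + 1 + 1 = 2 * (m + 1) by ring, hz0]
  · intro j hj
    obtain ⟨m, rfl | rfl⟩ : ∃ m, j = 2 * m ∨ j = 2 * m + 1 := ⟨j / 2, by omega⟩
    · simpa [hz0, hz1] using (hq m (by omega)).2.2.1
    · simpa [show 2 * m + 1 + 1 = 2 * (m + 1) by ring, hz0, hz1] using
        (hq m (by omega)).2.2.2.1
  · intro j hj
    obtain ⟨m, rfl | rfl⟩ : ∃ m, j = 2 * m ∨ j = 2 * m + 1 := ⟨j / 2, by omega⟩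
    · obtain ⟨-, -, h1, h2, h3, h4⟩ := hq m (by omega)
      rw [show 2 * m + 2 = 2 * (m + 1) by ring, hz0, hz0, hz1, cross_eq_shear _ _ goldenRatio]
      simp only [Prod.fst_sub, Prod.snd_sub]
      refine ne_of_gt ?_
      nlinarith [mul_pos (sub_pos.2 h1) (sub_pos.2 h4),
        mul_nonneg (sub_nonneg.2 h3) (sub_pos.2 h2).le]
    · obtain ⟨-, -, -, h2, -, h4⟩ := hq m (by omega)
      obtain ⟨-, -, h1, -, h3, -⟩ := hq (m + 1) (by omega)
      rw [show 2 * m + 1 + 2 = 2 * (m + 1) + 1 by ring, show 2 * m + 1 + 1 = 2 * (m + 1) by ring,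
        hz0, hz1, hz1, cross_eq_shear _ _ goldenRatio]
      simp only [Prod.fst_sub, Prod.snd_sub]
      refine ne_of_lt ?_
      nlinarith [mul_pos (sub_pos.2 h1) (sub_pos.2 h4),
        mul_nonneg (sub_nonneg.2 h3) (sub_pos.2 h2).le]

theorem HasMonotonePathOfLength.mono {L L' : Finset (Set (ℝ × ℝ))} {k : ℕ}
    (h : HasMonotonePathOfLength L k) (hsub : L ⊆ L') : HasMonotonePathOfLength L' k := by
  obtain ⟨v, h1, h2, h3, h4⟩ := h
  refine ⟨v, fun i hi => ?_, fun i hi => ?_, h3, h4⟩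
  · obtain ⟨l, hl, l', hl', h⟩ := h1 i hi
    exact ⟨l, hsub hl, l', hsub hl', h⟩
  · obtain ⟨l, hl, h⟩ := h2 i hi
    exact ⟨l, hsub hl, h⟩

theorem infinite_isLine : Infinite {l : Set (ℝ × ℝ) // IsLine l} := by
  refine Infinite.of_injective
    (fun c : ℝ => (⟨{p | 1 * p.1 + 0 * p.2 = c}, 1, 0, c, by simp, rfl⟩ :
      {l : Set (ℝ × ℝ) // IsLine l})) fun c d h => ?_
  have hmem : ((c, 0) : ℝ × ℝ) ∈ {p : ℝ × ℝ | 1 * p.1 + 0 * p.2 = d} := by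
    have heq : {p : ℝ × ℝ | 1 * p.1 + 0 * p.2 = c} = {p : ℝ × ℝ | 1 * p.1 + 0 * p.2 = d} :=
      Subtype.ext_iff.1 h
    rw [← heq]; simp
  simpa using hmem

theorem exists_superset_isLine_card_eq {L : Finset (Set (ℝ × ℝ))} (hL : ∀ l ∈ L, IsLine l) {n : ℕ}
    (hn : L.card ≤ n) : ∃ L' : Finset (Set (ℝ × ℝ)), L ⊆ L' ∧ (∀ l ∈ L', IsLine l) ∧
      L'.card = n := by
  classical
  have := infinite_isLine
  obtain ⟨S, hS, hcard⟩ := Infinite.exists_superset_card_eq (L.subtype IsLine) n (by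
    rwa [Finset.card_subtype, Finset.filter_true_of_mem hL])
  refine ⟨S.map (Function.Embedding.subtype _), fun l hl => ?_, fun l hl => ?_, by simpa⟩
  · exact Finset.mem_map.2 ⟨⟨l, hL l hl⟩, hS (by simpa using hl), rfl⟩
  · obtain ⟨l, -, rfl⟩ := Finset.mem_map.1 hl
    exact l.2

theorem exists_two_lines_path : ∃ L : Finset (Set (ℝ × ℝ)), (∀ l ∈ L, IsLine l) ∧ L.card ≤ 2 ∧
    HasMonotonePathOfLength L 1 := by
  classical
  refine ⟨{{p | 1 * p.1 + 0 * p.2 = 0}, {p | 0 * p.1 + 1 * p.2 = 0}}, ?_, Finset.card_le_two,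
    fun _ => 0, fun i _ => ⟨_, Finset.mem_insert_self _ _, _,
      Finset.mem_insert_of_mem (Finset.mem_singleton_self _), fun h => ?_, by simp, by simp⟩,
    fun i _ => ⟨_, Finset.mem_insert_self _ _, by simp [segment_same]⟩,
    fun i hi => by omega, (1, 0), by simp, ?_⟩
  · intro l hl
    rcases Finset.mem_insert.1 hl with rfl | hl
    · exact ⟨1, 0, 0, by simp, rfl⟩
    · exact ⟨0, 1, 0, by simp, Finset.mem_singleton.1 hl⟩
  · have h0 : ((0, 1) : ℝ × ℝ) ∈ {p : ℝ × ℝ | 0 * p.1 + 1 * p.2 = 0} := by rw [← h]; simp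
    simp at h0
  · simp [segment_same]

theorem Realizable.mono {M Λ Λ' : ℕ} {B B' : ℕ → ℕ} (h : Realizable M Λ B) (hΛ : Λ ≤ Λ')
    (hB : ∀ k, B k ≤ B' k) : Realizable M Λ' B' := by
  obtain ⟨p, t, h1, h2, h3, h4⟩ := h
  exact ⟨p, t, h1, h2.trans hΛ, h3.trans hΛ, fun k => (h4 k).trans (hB k)⟩

theorem realizable_iterate (T J : ℕ) (hJ : J + 1 ≤ T) :
    Realizable (2 ^ (2 * (T ^ 2 - T ^ 2 / (J + 1))) - 1) (J * 2 ^ (T ^ 2 + 5 * T))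
      fun k => Nat.fib (k + 2) ^ J * 2 ^ (T ^ 2 - T ^ 2 / (J + 1)) := by
  induction J with
  | zero => simpa using realizable_zero
  | succ J ih =>
    have h := ih (by omega)
    have ha : (J + 1) * (T ^ 2 / (J + 1)) ≤ T ^ 2 := Nat.mul_div_le _ _
    have hb : T ^ 2 < (J + 2) * (T ^ 2 / (J + 2)) + (J + 2) := by
      rw [← Nat.mul_succ]; exact Nat.lt_mul_div_succ _ (by omega)
    have hab : T ^ 2 / (J + 2) ≤ T ^ 2 / (J + 1) := Nat.div_le_div_left (by omega) (by omega)
    have haT : T ^ 2 / (J + 1) ≤ T ^ 2 := Nat.div_le_self _ _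
    simp only [show J + 1 + 1 = J + 2 from rfl]
    generalize T ^ 2 / (J + 1) = a at *
    generalize T ^ 2 / (J + 2) = b at *
    generalize T ^ 2 = S at *
    obtain ⟨ν, rfl⟩ := Nat.exists_eq_add_of_le hab
    obtain ⟨c, rfl⟩ := Nat.exists_eq_add_of_le haT
    obtain ⟨κ, hκ, hκ1, hκ2⟩ := exists_even_fib_ge (2 ^ ν) Nat.one_le_two_pow
    have e1 : b + ν + c - (b + ν) = c := by omega
    have e2 : b + ν + c - b = ν + c := by omega
    rw [e1] at h
    rw [e2]
    have hres := h.refine Nat.one_le_two_pow hκ hκ1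
    have hM : (2 ^ (2 * c) - 1 + 1) * (2 ^ ν) ^ 2 - 1 = 2 ^ (2 * (ν + c)) - 1 := by
      rw [Nat.sub_add_cancel Nat.one_le_two_pow]
      ring_nf
    rw [hM] at hres
    refine hres.mono ?_ fun k => le_of_eq (by ring)
    have hfib : Nat.fib (κ + 3) ≤ 2 ^ (ν + 4) := hκ2.trans (le_of_eq (by ring))
    have hfib' : Nat.fib (κ + 2) ≤ 2 ^ (ν + 4) := (Nat.fib_mono (by omega)).trans hfib
    rw [add_one_mul]
    refine Nat.add_le_add_left ?_ _
    calc _ ≤ ((2 ^ (ν + 4)) ^ J * 2 ^ c + (2 ^ (ν + 4)) ^ J * 2 ^ c) * (2 ^ ν) ^ 2 := by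
          gcongr
      _ = 2 ^ (1 + (ν + 4) * J + c + 2 * ν) := by
          rw [← two_mul, ← pow_mul, ← pow_mul]; ring
      _ ≤ _ := by
          refine Nat.pow_le_pow_right (by norm_num) ?_
          nlinarith

theorem exists_lines_of_level {T : ℕ} (hT : 2 ≤ T) :
    ∃ L : Finset (Set (ℝ × ℝ)), (∀ l ∈ L, IsLine l) ∧ L.card ≤ 2 ^ (T ^ 2 + 7 * T) ∧
      ∃ k, 2 ^ (2 * (T ^ 2 - T)) ≤ k ∧ HasMonotonePathOfLength L k := by
  obtain ⟨J, rfl⟩ : ∃ J, T = J + 1 := ⟨T - 1, by omega⟩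
  have h := realizable_iterate (J + 1) J le_rfl
  have hdiv : (J + 1) ^ 2 / (J + 1) = J + 1 := by
    rw [sq, Nat.mul_div_cancel _ (Nat.succ_pos J)]
  rw [hdiv] at h
  have h16 : 2 ^ 4 ≤ 2 ^ (2 * ((J + 1) ^ 2 - (J + 1))) := by
    refine Nat.pow_le_pow_right (by norm_num) ?_
    have : (J + 1) * 2 ≤ (J + 1) ^ 2 := by rw [sq]; gcongr
    omega
  obtain ⟨L, hL, hcard, hpath⟩ := h.exists_lines (by omega)
  refine ⟨L, hL, hcard.trans ?_, _, ?_, hpath⟩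
  · have h1 : J ≤ 2 ^ J := Nat.lt_two_pow_self.le
    calc 2 * (J * 2 ^ ((J + 1) ^ 2 + 5 * (J + 1)))
        ≤ 2 * (2 ^ J * 2 ^ ((J + 1) ^ 2 + 5 * (J + 1))) := by gcongr
      _ = 2 ^ (1 + J + ((J + 1) ^ 2 + 5 * (J + 1))) := by ring
      _ ≤ _ := Nat.pow_le_pow_right (by norm_num) (by omega)
  · omega

theorem exists_level {n : ℕ} (hn : 2 ≤ n) :
    ∃ T, 2 ^ (T ^ 2 + 7 * T) ≤ n ∧ n < 2 ^ ((T + 1) ^ 2 + 7 * (T + 1)) := by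
  classical
  have hex : ∃ T, n < 2 ^ ((T + 1) ^ 2 + 7 * (T + 1)) :=
    ⟨n, Nat.lt_two_pow_self.trans_le (Nat.pow_le_pow_right (by norm_num) (by nlinarith))⟩
  refine ⟨Nat.find hex, ?_, Nat.find_spec hex⟩
  rcases h : Nat.find hex with _ | T
  · simp; omega
  · exact not_lt.1 (Nat.find_min hex (by omega : T < Nat.find hex))

theorem rpow_two_sub_div_sqrt_logb_le {n T : ℕ} (hn : 2 ≤ n) (h1 : 2 ^ (T ^ 2 + 7 * T) ≤ n)
    (h2 : n < 2 ^ ((T + 1) ^ 2 + 7 * (T + 1))) :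
    (2 : ℝ) ^ (-36 : ℝ) * (n : ℝ) ^ (2 - 20 / Real.sqrt (Real.logb 2 n)) ≤
        2 ^ (2 * (T : ℝ) ^ 2 - 2 * T) ∧
      (T ≤ 1 → (2 : ℝ) ^ (-36 : ℝ) * (n : ℝ) ^ (2 - 20 / Real.sqrt (Real.logb 2 n)) ≤ 1) := by
  have hn0 : (0 : ℝ) < n := by positivity
  have hx1 : ((T : ℝ) ^ 2 + 7 * T) ≤ Real.logb 2 n := by
    rw [Real.le_logb_iff_rpow_le (by norm_num) hn0]
    exact_mod_cast h1
  have hx2 : Real.logb 2 n < ((T : ℝ) + 1) ^ 2 + 7 * (T + 1) := by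
    rw [Real.logb_lt_iff_lt_rpow (by norm_num) hn0]
    exact_mod_cast h2
  have hx0 : 0 < Real.logb 2 n :=
    Real.logb_pos (by norm_num) (by exact_mod_cast (by omega : 1 < n))
  have hn2 : (n : ℝ) = 2 ^ Real.logb 2 n := (Real.rpow_logb (by norm_num) (by norm_num) hn0).symm
  generalize hx : Real.logb 2 n = x at *
  have hs0 : 0 < √x := Real.sqrt_pos.2 hx0
  have hsq : √x ^ 2 = x := Real.sq_sqrt hx0.le
  have hT0 : (0 : ℝ) ≤ T := Nat.cast_nonneg _
  have hsT : (T : ℝ) ≤ √x := Real.le_sqrt_of_sq_le (by linarith)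
  have hlhs : (2 : ℝ) ^ (-36 : ℝ) * (n : ℝ) ^ (2 - 20 / √x) = 2 ^ (-36 + (2 * x - 20 * √x)) := by
    rw [hn2, ← Real.rpow_mul (by norm_num), ← Real.rpow_add (by norm_num)]
    congr 2
    field_simp
    linear_combination 20 * hsq
  rw [hlhs]
  refine ⟨Real.rpow_le_rpow_of_exponent_le (by norm_num) (by nlinarith), fun hT => ?_⟩
  have hT' : (T : ℝ) ≤ 1 := by exact_mod_cast hT
  exact Real.rpow_le_one_of_one_le_of_nonpos (by norm_num) (by nlinarith)

/-- (Balogh et al.) There are constants `β, c > 0` such that for every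
`n ≥ 2` there is a set of `n` lines in the plane admitting a monotone path of length at
least `β · n^(2 - c/√(log₂ n))`. -/
theorem exists_lines_with_long_monotone_path :
    ∃ β c : ℝ, 0 < β ∧ 0 < c ∧ ∀ n : ℕ, 2 ≤ n →
      ∃ L : Finset (Set (ℝ × ℝ)), (∀ l ∈ L, IsLine l) ∧ L.card = n ∧
        ∃ k : ℕ, β * (n : ℝ) ^ (2 - c / Real.sqrt (Real.logb 2 n)) ≤ k ∧
          HasMonotonePathOfLength L k := by
  refine ⟨2 ^ (-36 : ℝ), 20, by positivity, by norm_num, fun n hn => ?_⟩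
  obtain ⟨T, h1, h2⟩ := exists_level hn
  obtain ⟨hbound, hbound'⟩ := rpow_two_sub_div_sqrt_logb_le hn h1 h2
  suffices ∃ L : Finset (Set (ℝ × ℝ)), (∀ l ∈ L, IsLine l) ∧ L.card ≤ n ∧
      ∃ k : ℕ, 2 ^ (-36 : ℝ) * (n : ℝ) ^ (2 - 20 / Real.sqrt (Real.logb 2 n)) ≤ k ∧
        HasMonotonePathOfLength L k by
    obtain ⟨L, hL, hcard, k, hk, hpath⟩ := this
    obtain ⟨L', hsub, hL', hcard'⟩ := exists_superset_isLine_card_eq hL hcard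
    exact ⟨L', hL', hcard', k, hk, hpath.mono hsub⟩
  rcases le_or_gt T 1 with hT | hT
  · obtain ⟨L, hL, hcard, hpath⟩ := exists_two_lines_path
    exact ⟨L, hL, hcard.trans hn, 1, by simpa using hbound' hT, hpath⟩
  · obtain ⟨L, hL, hcard, k, hk, hpath⟩ := exists_lines_of_level hT
    refine ⟨L, hL, hcard.trans h1, k, hbound.trans ?_, hpath⟩
    have hTT : T ≤ T ^ 2 := Nat.le_self_pow (by norm_num) T
    calc (2 : ℝ) ^ (2 * (T : ℝ) ^ 2 - 2 * T) = ((2 ^ (2 * (T ^ 2 - T)) : ℕ) : ℝ) := by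
          rw [Nat.cast_pow, Nat.cast_ofNat, ← Real.rpow_natCast 2 (2 * (T ^ 2 - T))]
          congr 1
          push_cast [hTT]
          ring
      _ ≤ k := by exact_mod_cast hk
end

section
/- Let f : ℝ^d → ℝ be continuous, and let f_1, …, f_n : ℝ^d → ℝ be affine functions such that for every x ∈ ℝ^d there exists j ∈ {1,…,n} with f(x) = f_j(x). Fix i ∈ {1,…,n} and let U ⊆ ℝ^d be an open connected set such that f_j(x) ≠ f_i(x) for all x ∈ U and all j ≠ i. If f(x₀) = f_i(x₀) for some x₀ ∈ U, then f(x) = f_i(x) for all x ∈ U. -/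
/-- An affine function `ℝ^d → ℝ`, i.e. a map of the form `x ↦ ⟨a, x⟩ + b`. -/
def IsAffineFn {d : ℕ} (g : (Fin d → ℝ) → ℝ) : Prop :=
  ∃ (a : Fin d → ℝ) (b : ℝ), ∀ x, g x = (∑ i, a i * x i) + b

/-- `f` agrees with some affine map on the set `P`. -/
def AffineOnSet {d : ℕ} (f : (Fin d → ℝ) → ℝ) (P : Set (Fin d → ℝ)) : Prop :=
  ∃ g : (Fin d → ℝ) → ℝ, IsAffineFn g ∧ ∀ x ∈ P, f x = g x

/-- `Ps` is an admissible (finite) set of pieces for `f`: all pieces are open,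
connected, `f` is affine on each of them, and their closures cover `ℝ^d`. -/
def IsPieceSet {d : ℕ} (f : (Fin d → ℝ) → ℝ) (Ps : Finset (Set (Fin d → ℝ))) : Prop :=
  (∀ P ∈ Ps, IsOpen P ∧ IsConnected P ∧ AffineOnSet f P) ∧
    (⋃ P ∈ Ps, closure P) = Set.univ

/-- A continuous piecewise affine (CPA) function. -/
def IsCPA {d : ℕ} (f : (Fin d → ℝ) → ℝ) : Prop :=
  Continuous f ∧ ∃ Ps : Finset (Set (Fin d → ℝ)), IsPieceSet f Ps

/-- `P` is a maximal piece of `f`: open, connected, `f` affine on `P`, and it cannot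
be enlarged by a nonempty set `U ⊆ ℝ^d \ P` keeping openness, connectedness and affineness. -/
def IsMaximalPiece {d : ℕ} (f : (Fin d → ℝ) → ℝ) (P : Set (Fin d → ℝ)) : Prop :=
  IsOpen P ∧ IsConnected P ∧ AffineOnSet f P ∧
    ¬ ∃ U : Set (Fin d → ℝ), U.Nonempty ∧ U ⊆ Pᶜ ∧ IsOpen (P ∪ U) ∧
      IsConnected (P ∪ U) ∧ AffineOnSet f (P ∪ U)

theorem IsAffineFn.continuous {d : ℕ} {g : (Fin d → ℝ) → ℝ} (hg : IsAffineFn g) :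
    Continuous g := by
  obtain ⟨a, b, h⟩ := hg
  rw [funext h]
  fun_prop

/-- If `f` is continuous and agrees everywhere with one of the affine
functions `F j`, and on an open connected set `U` all `F j` with `j ≠ i` differ from
`F i` at every point, then `f = F i` at one point of `U` implies `f = F i` on all of
`U`. -/
theorem affine_component_spreads {d n : ℕ} (f : (Fin d → ℝ) → ℝ) (hf : Continuous f)
    (F : Fin n → (Fin d → ℝ) → ℝ) (hF : ∀ j, IsAffineFn (F j))
    (hcover : ∀ x, ∃ j, f x = F j x)
    (i : Fin n) (U : Set (Fin d → ℝ)) (hUopen : IsOpen U) (hUconn : IsConnected U)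
    (hne : ∀ x ∈ U, ∀ j, j ≠ i → F j x ≠ F i x)
    (x₀ : Fin d → ℝ) (hx₀ : x₀ ∈ U) (hfx₀ : f x₀ = F i x₀) :
    ∀ x ∈ U, f x = F i x := by
  have hFc : ∀ j, Continuous (F j) := fun j => (hF j).continuous
  have hA : IsClosed {x | f x = F i x} := isClosed_eq hf (hFc i)
  have hB : IsClosed (⋃ j ∈ {j | j ≠ i}, {x | f x = F j x}) :=
    (Set.toFinite _).isClosed_biUnion fun j _ => isClosed_eq hf (hFc j)
  have hUcover : U ⊆ {x | f x = F i x} ∪ ⋃ j ∈ {j | j ≠ i}, {x | f x = F j x} := by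
    intro x _
    obtain ⟨j, hj⟩ := hcover x
    by_cases hji : j = i
    · exact Or.inl (hji ▸ hj)
    · exact Or.inr (Set.mem_biUnion hji hj)
  intro x hx
  by_contra hxi
  obtain ⟨y, hyU, hyi, hyB⟩ := isPreconnected_closed_iff.1 hUconn.isPreconnected _ _ hA hB
    hUcover ⟨x₀, hx₀, hfx₀⟩ ⟨x, hx, (hUcover hx).resolve_left hxi⟩
  obtain ⟨j, hji, hyj⟩ := Set.mem_iUnion₂.1 hyB
  exact hne y hyU j hji (Eq.trans (Eq.symm hyj) hyi)
end

section
/- Let f : ℝ^d → ℝ be continuous and let 𝒫₁ and 𝒫₂ be two finite sets of maximal pieces of f, each satisfying ℝ^d = ⋃_{P ∈ 𝒫₁} closure(P) and ℝ^d = ⋃_{P ∈ 𝒫₂} closure(P). Then 𝒫₁ = 𝒫₂; that is, the set of pieces of a CPA function consisting only of maximal pieces is unique. -/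
/-- Affine functions are compatible with affine interpolation. -/
lemma IsAffineFn.map_add_smul_sub {d : ℕ} {g : (Fin d → ℝ) → ℝ} (hg : IsAffineFn g)
    (x y : Fin d → ℝ) (t : ℝ) : g (x + t • (y - x)) = g x + t * (g y - g x) := by
  obtain ⟨a, b, hab⟩ := hg
  simp only [hab, Pi.add_apply, Pi.smul_apply, Pi.sub_apply, smul_eq_mul]
  rw [add_sub_add_right_eq_sub, ← Finset.sum_sub_distrib, Finset.mul_sum, add_right_comm,
    ← Finset.sum_add_distrib]
  congr 1
  exact Finset.sum_congr rfl fun i _ ↦ by ring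

/-- Two affine functions which agree on a nonempty open set are equal. -/
lemma IsAffineFn.eq_of_eqOn_isOpen {d : ℕ} {g h : (Fin d → ℝ) → ℝ} (hg : IsAffineFn g)
    (hh : IsAffineFn h) {V : Set (Fin d → ℝ)} (hV : IsOpen V) (hne : V.Nonempty)
    (hgh : Set.EqOn g h V) : g = h := by
  obtain ⟨x, hx⟩ := hne
  funext y
  have hcont : Continuous fun t : ℝ ↦ x + t • (y - x) := by fun_prop
  have hnhds : ∀ᶠ t in nhdsWithin (0 : ℝ) {0}ᶜ, x + t • (y - x) ∈ V :=
    (hcont.continuousAt.eventually (hV.mem_nhds (by simpa using hx))).filter_mono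
      nhdsWithin_le_nhds
  obtain ⟨t, htV, ht⟩ := (hnhds.and self_mem_nhdsWithin).exists
  have key := hgh htV
  rw [hg.map_add_smul_sub, hh.map_add_smul_sub, hgh hx] at key
  have := mul_left_cancel₀ ht (add_left_cancel key)
  linarith

/-- If `f` is affine on two open sets which meet, then it is affine on their union. -/
lemma AffineOnSet.union {d : ℕ} {f : (Fin d → ℝ) → ℝ} {P Q : Set (Fin d → ℝ)}
    (hfP : AffineOnSet f P) (hfQ : AffineOnSet f Q) (hP : IsOpen P) (hQ : IsOpen Q)
    (hne : (P ∩ Q).Nonempty) : AffineOnSet f (P ∪ Q) := by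
  obtain ⟨g, hg, hfg⟩ := hfP
  obtain ⟨h, hh, hfh⟩ := hfQ
  obtain rfl : g = h := hg.eq_of_eqOn_isOpen hh (hP.inter hQ) hne fun x hx ↦
    (hfg x hx.1).symm.trans (hfh x hx.2)
  exact ⟨g, hg, fun x hx ↦ hx.elim (hfg x) (hfh x)⟩

/-- A maximal piece contains every open connected set meeting it on which `f` is affine. -/
lemma IsMaximalPiece.subset_of_inter_nonempty {d : ℕ} {f : (Fin d → ℝ) → ℝ}
    {P Q : Set (Fin d → ℝ)} (hP : IsMaximalPiece f P) (hQ : IsOpen Q) (hQc : IsConnected Q)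
    (hfQ : AffineOnSet f Q) (hne : (P ∩ Q).Nonempty) : Q ⊆ P := by
  obtain ⟨hPo, hPc, hfP, hmax⟩ := hP
  by_contra hQP
  refine hmax ⟨Q \ P, Set.sdiff_nonempty.2 hQP, fun x hx ↦ hx.2, ?_⟩
  rw [Set.union_sdiff_self]
  exact ⟨hPo.union hQ, hPc.union hne hQc, hfP.union hfQ hPo hQ hne⟩

/-- Two maximal pieces which meet are equal. -/
lemma IsMaximalPiece.eq_of_inter_nonempty {d : ℕ} {f : (Fin d → ℝ) → ℝ}
    {P Q : Set (Fin d → ℝ)} (hP : IsMaximalPiece f P) (hQ : IsMaximalPiece f Q)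
    (hne : (P ∩ Q).Nonempty) : P = Q :=
  (hQ.subset_of_inter_nonempty hP.1 hP.2.1 hP.2.2.1 (Set.inter_comm P Q ▸ hne)).antisymm
    (hP.subset_of_inter_nonempty hQ.1 hQ.2.1 hQ.2.2.1 hne)

/-- A set of maximal pieces whose closures cover the space contains every maximal piece. -/
lemma IsMaximalPiece.mem_of_iUnion_closure_eq_univ {d : ℕ} {f : (Fin d → ℝ) → ℝ}
    {P : Set (Fin d → ℝ)} (hP : IsMaximalPiece f P) {Qs : Finset (Set (Fin d → ℝ))}
    (hQs : ∀ Q ∈ Qs, IsMaximalPiece f Q) (hcover : (⋃ Q ∈ Qs, closure Q) = Set.univ) :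
    P ∈ Qs := by
  obtain ⟨x, hx⟩ := hP.2.1.nonempty
  have hxQ : x ∈ ⋃ Q ∈ Qs, closure Q := hcover ▸ Set.mem_univ x
  obtain ⟨Q, hQ, hxQ⟩ := Set.mem_iUnion₂.1 hxQ
  rwa [hP.eq_of_inter_nonempty (hQs Q hQ) (mem_closure_iff.1 hxQ P hP.1 hx)]

/-- Two finite sets of maximal pieces of a continuous function whose
closures each cover `ℝ^d` coincide: the set of pieces consisting of maximal pieces is
unique. -/
theorem maximal_pieceSet_unique {d : ℕ} (f : (Fin d → ℝ) → ℝ) (hf : Continuous f)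
    (Ps₁ Ps₂ : Finset (Set (Fin d → ℝ)))
    (h₁ : ∀ P ∈ Ps₁, IsMaximalPiece f P) (h₂ : ∀ P ∈ Ps₂, IsMaximalPiece f P)
    (hcover₁ : (⋃ P ∈ Ps₁, closure P) = Set.univ)
    (hcover₂ : (⋃ P ∈ Ps₂, closure P) = Set.univ) :
    Ps₁ = Ps₂ := by
  refine Finset.Subset.antisymm (fun P hP ↦ ?_) (fun P hP ↦ ?_)
  · exact (h₁ P hP).mem_of_iUnion_closure_eq_univ h₂ hcover₂
  · exact (h₂ P hP).mem_of_iUnion_closure_eq_univ h₁ hcover₁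
end
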